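/- Let S be a dual blocking set in PG(2,q), q > 2, that is minimal with respect to inclusion (no proper subset of S is a dual blocking set). Then exactly one of the following holds: (i) there is a line ℓ and, for each point P ∈ ℓ, a line ℓ_P ≠ ℓ through P, such that S = (⋃_{P∈ℓ} ℓ_P) \ ℓ; or (ii) there are two distinct lines ℓ and m such that S = PG(2,q) \ (ℓ ∪ m). -/

import Mathlib

/-- A point of `PG(2,q)`: a 1-dimensional linear subspace of `F³`. -/
abbrev ProjPoint (F : Type*) [Field F] :=
  {W : Submodule F (Fin 3 → F) // Module.finrank F W = 1}

/-- A line of `PG(2,q)`: a 2-dimensional linear subspace of `F³`. -/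
abbrev ProjLine (F : Type*) [Field F] :=
  {W : Submodule F (Fin 3 → F) // Module.finrank F W = 2}

/-- The set of points of `PG(2,q)` lying on a line `L`. -/
def linePoints {F : Type*} [Field F] (L : ProjLine F) : Set (ProjPoint F) :=
  {P : ProjPoint F | P.1 ≤ L.1}

/-- A blocking set in `PG(2,q)`: a set of points meeting every line and
containing no line. -/
def IsBlockingSet {F : Type*} [Field F] (B : Set (ProjPoint F)) : Prop :=
  (∀ L : ProjLine F, ∃ P ∈ B, P.1 ≤ L.1) ∧ ∀ L : ProjLine F, ¬ linePoints L ⊆ B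

/-- A dual blocking set in `PG(2,q)`: a set of points meeting every blocking
set and containing no line. -/
def IsDualBlockingSet {F : Type*} [Field F] (S : Set (ProjPoint F)) : Prop :=
  (∀ B : Set (ProjPoint F), IsBlockingSet B → (S ∩ B).Nonempty) ∧
    ∀ L : ProjLine F, ¬ linePoints L ⊆ S

/-- Two lines meet. -/
lemma line_meet {F : Type*} [Field F] (L M : ProjLine F) :
    ∃ P : ProjPoint F, P.1 ≤ L.1 ∧ P.1 ≤ M.1 := by
  have h1 := Submodule.finrank_sup_add_finrank_inf_eq L.1 M.1
  have h2 : Module.finrank F (L.1 ⊔ M.1 : Submodule F (Fin 3 → F)) ≤ 3 := by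
    simpa using Submodule.finrank_le (L.1 ⊔ M.1)
  rw [L.2, M.2] at h1
  have h3 : (L.1 ⊓ M.1) ≠ ⊥ := by
    intro h
    rw [h, finrank_bot] at h1
    omega
  obtain ⟨x, hx, hx0⟩ := Submodule.exists_mem_ne_zero_of_ne_bot h3
  refine ⟨⟨Submodule.span F {x}, finrank_span_singleton hx0⟩, ?_, ?_⟩
  · simpa [Submodule.span_singleton_le_iff_mem] using hx.1
  · simpa [Submodule.span_singleton_le_iff_mem] using hx.2

lemma sup_finrank {F : Type*} [Field F] {P Q : ProjPoint F} (h : P ≠ Q) :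
    Module.finrank F (P.1 ⊔ Q.1 : Submodule F (Fin 3 → F)) = 2 := by
  have h1 := Submodule.finrank_sup_add_finrank_inf_eq P.1 Q.1
  rw [P.2, Q.2] at h1
  have h3 : P.1 ⊓ Q.1 = ⊥ := by
    by_contra h0
    have h4 : 1 ≤ Module.finrank F (P.1 ⊓ Q.1 : Submodule F (Fin 3 → F)) :=
      Submodule.one_le_finrank_iff.2 h0
    have h5 : P.1 ⊓ Q.1 = P.1 :=
      Submodule.eq_of_le_of_finrank_le inf_le_left (by rw [P.2]; exact h4)
    have h6 : P.1 ⊓ Q.1 = Q.1 :=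
      Submodule.eq_of_le_of_finrank_le inf_le_right (by rw [Q.2]; exact h4)
    exact h (Subtype.ext (h5.symm.trans h6))
  rw [h3, finrank_bot] at h1
  omega

/-- Two distinct points are on a line. -/
lemma point_join {F : Type*} [Field F] {P Q : ProjPoint F} (h : P ≠ Q) :
    ∃ L : ProjLine F, P.1 ≤ L.1 ∧ Q.1 ≤ L.1 :=
  ⟨⟨P.1 ⊔ Q.1, sup_finrank h⟩, le_sup_left, le_sup_right⟩

lemma line_unique {F : Type*} [Field F] {P Q : ProjPoint F} (h : P ≠ Q) {L M : ProjLine F}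
    (h1 : P.1 ≤ L.1) (h2 : Q.1 ≤ L.1) (h3 : P.1 ≤ M.1) (h4 : Q.1 ≤ M.1) : L = M := by
  have a := Submodule.eq_of_le_of_finrank_eq (sup_le h1 h2) ((sup_finrank h).trans L.2.symm)
  have b := Submodule.eq_of_le_of_finrank_eq (sup_le h3 h4) ((sup_finrank h).trans M.2.symm)
  exact Subtype.ext (a.symm.trans b)

/-- For `q > 2` every line has a fourth point. -/
lemma line_fourth {F : Type*} [Field F] [Fintype F] (hq : 2 < Fintype.card F)
    (L : ProjLine F) (A B C : ProjPoint F) :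
    ∃ P : ProjPoint F, P.1 ≤ L.1 ∧ P ≠ A ∧ P ≠ B ∧ P ≠ C := by
  classical
  let b := Module.finBasisOfFinrankEq F L.1 L.2
  have hli : LinearIndependent F (fun i => (b i : Fin 3 → F)) :=
    b.linearIndependent.map' L.1.subtype (Submodule.ker_subtype _)
  have hli' := LinearIndependent.pair_iff.1
    (show LinearIndependent F ![(b 0 : Fin 3 → F), (b 1 : Fin 3 → F)] by
      convert hli using 1
      ext i : 1
      fin_cases i <;> rfl)
  generalize hu : (b 0 : Fin 3 → F) = u at hli'
  generalize hv : (b 1 : Fin 3 → F) = v at hli'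
  have huL : u ∈ L.1 := hu ▸ (b 0).2
  have hvL : v ∈ L.1 := hv ▸ (b 1).2
  let w : Option F → (Fin 3 → F) := fun o => o.elim v (fun t => u + t • v)
  have hw0 : ∀ o, w o ≠ 0 := by
    rintro (_ | t) h
    · have := hli' 0 1 (by simpa [w] using h)
      simp at this
    · have := hli' 1 t (by simpa [w] using h)
      simp at this
  have hwL : ∀ o, w o ∈ L.1 := by
    rintro (_ | t)
    · exact hvL
    · exact L.1.add_mem huL (L.1.smul_mem t hvL)
  let g : Option F → ProjPoint F := fun o =>
    ⟨Submodule.span F {w o}, finrank_span_singleton (hw0 o)⟩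
  have hg : Function.Injective g := by
    intro o o' h
    have h1 : Submodule.span F {w o} = Submodule.span F {w o'} := congrArg Subtype.val h
    have h2 : w o ∈ Submodule.span F {w o'} := h1 ▸ Submodule.mem_span_singleton_self _
    obtain ⟨c, hc⟩ := Submodule.mem_span_singleton.1 h2
    rcases o with _ | t <;> rcases o' with _ | s
    · rfl
    · have hc' : c • (u + s • v) = v := hc
      have := hli' c (c * s - 1) (by
        have : c • u + (c * s - 1) • v = c • (u + s • v) - v := by module
        rw [this, hc', sub_self])
      grind
    · have hc' : c • v = u + t • v := hc
      have := hli' 1 (t - c) (by rw [sub_smul, hc']; module)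
      grind
    · have hc' : c • (u + s • v) = u + t • v := hc
      have := hli' (c - 1) (c * s - t) (by
        have : (c - 1) • u + (c * s - t) • v = c • (u + s • v) - (u + t • v) := by module
        rw [this, hc', sub_self])
      grind
  by_contra! hcon
  have hsub : Finset.univ.image g ⊆ ({A, B, C} : Finset (ProjPoint F)) := by
    intro P hP
    obtain ⟨o, -, rfl⟩ := Finset.mem_image.1 hP
    have := hcon (g o) (by
      show Submodule.span F {w o} ≤ L.1
      rw [Submodule.span_singleton_le_iff_mem]; exact hwL o)
    simp only [Finset.mem_insert, Finset.mem_singleton]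
    tauto
  have h1 := Finset.card_le_card hsub
  rw [Finset.card_image_of_injective _ hg, Finset.card_univ, Fintype.card_option] at h1
  have h2 := Finset.card_le_three (a := A) (b := B) (c := C)
  omega

/-- A Kakeya set for `l` has points on every line `m ≠ l`. -/
lemma kakeya_meets {F : Type*} [Field F] [Fintype F] (hq : 2 < Fintype.card F)
    (l : ProjLine F) (f : ∀ P : ProjPoint F, P.1 ≤ l.1 → ProjLine F)
    (hf : ∀ (P : ProjPoint F) (h : P.1 ≤ l.1), P.1 ≤ (f P h).1 ∧ f P h ≠ l)
    (m : ProjLine F) (hm : l ≠ m) :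
    ∃ X : ProjPoint F, X.1 ≤ m.1 ∧ (∃ (P : ProjPoint F) (h : P.1 ≤ l.1), X.1 ≤ (f P h).1)
          ∧ ¬ X.1 ≤ l.1 := by
  obtain ⟨Q, hQl, hQm⟩ := line_meet l m
  obtain ⟨P, hP, hPQ, -⟩ := line_fourth hq l Q Q Q
  obtain ⟨X, hX, hXm⟩ := line_meet (f P hP) m
  refine ⟨X, hXm, ⟨P, hP, hX⟩, fun hXl => ?_⟩
  have hXP : X = P := by
    by_contra hne
    exact (hf P hP).2 (line_unique hne hX (hf P hP).1 hXl hP)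
  subst hXP
  exact hm (line_unique hPQ hP hQl hXm hQm)

/-- A dual blocking set disjoint from two lines contains everything outside of them. -/
lemma two_lines {F : Type*} [Field F] [Fintype F] (hq : 2 < Fintype.card F)
    (S : Set (ProjPoint F)) (hS : IsDualBlockingSet S) (l m : ProjLine F) (hlm : l ≠ m)
    (hl : ∀ P ∈ S, ¬ P.1 ≤ l.1) (hm : ∀ P ∈ S, ¬ P.1 ≤ m.1) :
    S = {P : ProjPoint F | ¬ P.1 ≤ l.1 ∧ ¬ P.1 ≤ m.1} := by
  ext R
  refine ⟨fun h => ⟨hl R h, hm R h⟩, fun ⟨hRl, hRm⟩ => ?_⟩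
  by_contra hRS
  obtain ⟨Q, hQl, hQm⟩ := line_meet l m
  have huniq : ∀ X : ProjPoint F, X.1 ≤ l.1 → X.1 ≤ m.1 → X = Q := by
    intro X h1 h2
    by_contra hne
    exact hlm (line_unique hne h1 hQl h2 hQm)
  obtain ⟨A, hA, hAQ, -⟩ := line_fourth hq l Q Q Q
  have hAR : A ≠ R := by rintro rfl; exact hRl hA
  obtain ⟨n, hAn, hRn⟩ := point_join hAR
  obtain ⟨B, hBn, hBm⟩ := line_meet n m
  have hBl : ¬ B.1 ≤ l.1 := by
    intro h
    have hBQ := huniq B h hBm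
    subst hBQ
    exact hRl (line_unique hAQ hAn hBn hA hQl ▸ hRn)
  have hBR : B ≠ R := by rintro rfl; exact hRm hBm
  have hAB : A ≠ B := by rintro rfl; exact hBl hA
  have hblock : IsBlockingSet
      {X : ProjPoint F | (X.1 ≤ l.1 ∨ X.1 ≤ m.1 ∨ X = R) ∧ X ≠ A ∧ X ≠ B} := by
    constructor
    · intro L
      obtain ⟨X, hXL, hXl⟩ := line_meet L l
      by_cases hXA : X = A
      · subst hXA
        obtain ⟨Y, hYL, hYm⟩ := line_meet L m
        by_cases hYB : Y = B
        · subst hYB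
          have : L = n := line_unique hAB hXL hYL hAn hBn
          subst this
          exact ⟨R, ⟨Or.inr (Or.inr rfl), hAR.symm, hBR.symm⟩, hRn⟩
        · refine ⟨Y, ⟨Or.inr (Or.inl hYm), ?_, hYB⟩, hYL⟩
          rintro rfl
          exact hAQ (huniq _ hXl hYm)
      · exact ⟨X, ⟨Or.inl hXl, hXA, fun h => hBl (h ▸ hXl)⟩, hXL⟩
    · intro L hL
      have hLl : L ≠ l := by
        rintro rfl
        exact (hL (show A ∈ linePoints _ from hA)).2.1 rfl
      have hLm : L ≠ m := by
        rintro rfl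
        exact (hL (show B ∈ linePoints _ from hBm)).2.2 rfl
      obtain ⟨X, hXL, hXl⟩ := line_meet L l
      obtain ⟨Y, hYL, hYm⟩ := line_meet L m
      obtain ⟨Z, hZ, hZX, hZY, hZR⟩ := line_fourth hq L X Y R
      rcases (hL (show Z ∈ linePoints L from hZ)).1 with h | h | h
      · exact hLl (line_unique hZX hZ hXL h hXl)
      · exact hLm (line_unique hZY hZ hYL h hYm)
      · exact hZR h
  obtain ⟨X, hXS, hX, -⟩ := hS.1 _ hblock
  rcases hX with h | h | h
  · exact hl X hXS h
  · exact hm X hXS h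
  · exact hRS (h ▸ hXS)

/-- If `T` is disjoint from `S` and meets every line, it contains a line. -/
lemma contains_line {F : Type*} [Field F] 
    (S : Set (ProjPoint F)) (hS : IsDualBlockingSet S) (T : Set (ProjPoint F))
    (hT : ∀ P ∈ S, P ∉ T) (h : ∀ L : ProjLine F, ∃ P ∈ T, P.1 ≤ L.1) :
    ∃ L : ProjLine F, linePoints L ⊆ T := by
  by_contra! hcon
  obtain ⟨X, hXS, hXT⟩ := hS.1 T ⟨h, hcon⟩
  exact hT X hXS hXT

/-- Every minimal dual blocking set `S` in `PG(2,q)`, `q > 2`, is of exactly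
one of the following two types: (i) a Kakeya set `(⋃_{P ∈ ℓ} ℓ_P) \ ℓ`, or
(ii) the complement of the union of two distinct lines. -/
theorem minimal_dual_blocking_classification {F : Type*} [Field F] [Fintype F]
    (hq : 2 < Fintype.card F)
    (S : Set (ProjPoint F)) (hS : IsDualBlockingSet S)
    (hmin : ∀ S' : Set (ProjPoint F), S' ⊂ S → ¬ IsDualBlockingSet S') :
    ((∃ (ℓ : ProjLine F) (f : ∀ P : ProjPoint F, P.1 ≤ ℓ.1 → ProjLine F),
        (∀ (P : ProjPoint F) (h : P.1 ≤ ℓ.1), P.1 ≤ (f P h).1 ∧ f P h ≠ ℓ) ∧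
        S = {Q : ProjPoint F | (∃ (P : ProjPoint F) (h : P.1 ≤ ℓ.1), Q.1 ≤ (f P h).1)
          ∧ ¬ Q.1 ≤ ℓ.1}) ∧
      ¬ (∃ ℓ m : ProjLine F, ℓ ≠ m ∧
        S = {P : ProjPoint F | ¬ P.1 ≤ ℓ.1 ∧ ¬ P.1 ≤ m.1})) ∨
    ((∃ ℓ m : ProjLine F, ℓ ≠ m ∧
        S = {P : ProjPoint F | ¬ P.1 ≤ ℓ.1 ∧ ¬ P.1 ≤ m.1}) ∧
      ¬ (∃ (ℓ : ProjLine F) (f : ∀ P : ProjPoint F, P.1 ≤ ℓ.1 → ProjLine F),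
        (∀ (P : ProjPoint F) (h : P.1 ≤ ℓ.1), P.1 ≤ (f P h).1 ∧ f P h ≠ ℓ) ∧
        S = {Q : ProjPoint F | (∃ (P : ProjPoint F) (h : P.1 ≤ ℓ.1), Q.1 ≤ (f P h).1)
          ∧ ¬ Q.1 ≤ ℓ.1})) := by
  have hexcl : ¬ ((∃ (ℓ : ProjLine F) (f : ∀ P : ProjPoint F, P.1 ≤ ℓ.1 → ProjLine F),
        (∀ (P : ProjPoint F) (h : P.1 ≤ ℓ.1), P.1 ≤ (f P h).1 ∧ f P h ≠ ℓ) ∧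
        S = {Q : ProjPoint F | (∃ (P : ProjPoint F) (h : P.1 ≤ ℓ.1), Q.1 ≤ (f P h).1)
          ∧ ¬ Q.1 ≤ ℓ.1}) ∧ (∃ ℓ m : ProjLine F, ℓ ≠ m ∧
        S = {P : ProjPoint F | ¬ P.1 ≤ ℓ.1 ∧ ¬ P.1 ≤ m.1})) := by
    rintro ⟨⟨k, f, hf, hSk⟩, l, m, hlm, hSlm⟩
    by_cases hkl : k = l
    · obtain ⟨X, hXm, hX⟩ := kakeya_meets hq k f hf m (hkl ▸ hlm)
      have hXS : X ∈ S := by rw [hSk]; exact hX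
      rw [hSlm] at hXS
      exact hXS.2 hXm
    · obtain ⟨X, hXm, hX⟩ := kakeya_meets hq k f hf l hkl
      have hXS : X ∈ S := by rw [hSk]; exact hX
      rw [hSlm] at hXS
      exact hXS.1 hXm
  suffices hmain : _ ∨ _ from
    hmain.elim (fun h => Or.inl ⟨h, fun h' => hexcl ⟨h, h'⟩⟩)
      (fun h => Or.inr ⟨h, fun h' => hexcl ⟨h', h⟩⟩)
  obtain ⟨l, hl⟩ := contains_line S hS Sᶜ (fun P hP h => h hP) (fun L => by
    obtain ⟨P, hPL, hPS⟩ := Set.not_subset.1 (hS.2 L)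
    exact ⟨P, hPS, hPL⟩)
  have hl' : ∀ P ∈ S, ¬ P.1 ≤ l.1 := fun P hP h => hl (show P ∈ linePoints l from h) hP
  by_cases hK : ∀ P : ProjPoint F, P.1 ≤ l.1 → ∃ n : ProjLine F, P.1 ≤ n.1 ∧ n ≠ l ∧
      ∀ X : ProjPoint F, X.1 ≤ n.1 → X ≠ P → X ∈ S
  · left
    choose f hf1 hf2 hf3 using hK
    refine ⟨l, f, fun P h => ⟨hf1 P h, hf2 P h⟩, ?_⟩
    by_contra hne
    refine hmin {Q : ProjPoint F | (∃ (P : ProjPoint F) (h : P.1 ≤ l.1), Q.1 ≤ (f P h).1)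
          ∧ ¬ Q.1 ≤ l.1} ?_ ⟨?_, ?_⟩
    · refine lt_of_le_of_ne ?_ (Ne.symm hne)
      rintro X ⟨⟨P, hP, hX⟩, hXl⟩
      exact hf3 P hP X hX (by rintro rfl; exact hXl hP)
    · intro B hB
      obtain ⟨P, hP, hPB⟩ := Set.not_subset.1 (hB.2 l)
      obtain ⟨X, hXB, hX⟩ := hB.1 (f P hP)
      refine ⟨X, ⟨⟨P, hP, hX⟩, fun hXl => ?_⟩, hXB⟩
      have hXP : X ≠ P := by rintro rfl; exact hPB hXB
      exact hf2 P hP (line_unique hXP hX (hf1 P hP) hXl hP)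
    · intro L hL
      obtain ⟨X, hXL, hXl⟩ := line_meet L l
      exact (hL (show X ∈ linePoints L from hXL)).2 hXl
  · right
    push Not at hK
    obtain ⟨P, hP, hK⟩ := hK
    obtain ⟨m, hm⟩ := contains_line S hS {X | X ∉ S ∧ X ≠ P} (fun X hX h => h.1 hX) (fun L => by
      by_cases hLl : L = l
      · subst hLl
        obtain ⟨X, hX, hXP, -⟩ := line_fourth hq L P P P
        exact ⟨X, ⟨fun h => hl' X h hX, hXP⟩, hX⟩
      by_cases hPL : P.1 ≤ L.1
      · obtain ⟨X, hX, hXP, hXS⟩ := hK L hPL hLl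
        exact ⟨X, ⟨hXS, hXP⟩, hX⟩
      · obtain ⟨X, hXL, hXl⟩ := line_meet L l
        exact ⟨X, ⟨fun h => hl' X h hXl, by rintro rfl; exact hPL hXL⟩, hXL⟩)
    have hlm : l ≠ m := by
      rintro rfl
      exact (hm (show P ∈ linePoints l from hP)).2 rfl
    exact ⟨l, m, hlm, two_lines hq S hS l m hlm hl'
      (fun X hX h => (hm (show X ∈ linePoints m from h)).1 hX)⟩
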